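/- arXiv:1903.00541 — 3 statements merged into one kernel-verified Lean document; each statement's English description precedes it below -/
import Mathlib

section
/- Let 1 ≤ p < q ≤ ∞ with 1/p = 1/q + 1/s, and let σ = (σ_k)_{k≥1} be a non-increasing sequence of positive real numbers with σ_k → 0. Then for all n ≥ 1 the n-th entropy number of the diagonal operator D_σ : ℓ_p → ℓ_q satisfies e_n(D_σ) ≤ 4 · sup_{k≥1} ( (λ^k(B_{ℓ_p^k}) / λ^k(B_{ℓ_q^k})) · (2σ_1 + k^{1/s} σ_k)·(2σ_2 + k^{1/s} σ_k)·…·(2σ_k + k^{1/s} σ_k) / n )^{1/k}, where λ^k denotes k-dimensional Lebesgue measure and B_{ℓ_p^k} is the closed unit ball of ℝ^k with the ℓ_p norm. -/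
open Metric Filter MeasureTheory
open scoped ENNReal

/-- The `n`-th (inner) entropy number of a set `T` in a normed space: the infimum of all
`ε > 0` such that `T` can be covered by `n` closed balls of radius `ε`. -/
noncomputable def entropyNumber {Y : Type*} [SeminormedAddCommGroup Y]
    (n : ℕ) (T : Set Y) : ℝ :=
  sInf {ε : ℝ | 0 < ε ∧ ∃ y : Fin n → Y, T ⊆ ⋃ i, Metric.closedBall (y i) ε}

/-- The `k`-dimensional Lebesgue volume of the closed unit ball of `ℓ_p^k = PiLp p ℝ^k`
(computed in the underlying space `Fin k → ℝ`). -/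
noncomputable def ballVolume (p : ℝ≥0∞) [Fact (1 ≤ p)] (k : ℕ) : ℝ≥0∞ :=
  volume ((WithLp.equiv p (∀ _ : Fin k, ℝ)) ''
    Metric.closedBall (0 : PiLp p (fun _ : Fin k => ℝ)) 1)


lemma aux_pos (p : ℝ≥0∞) [hp : Fact (1 ≤ p)] (h : p ≠ ⊤) : 1 ≤ p.toReal := by
  have := ENNReal.toReal_mono h hp.out
  simpa using this

lemma aux_norm_pow {p : ℝ≥0∞} [Fact (1 ≤ p)] (h : p ≠ ⊤) {k : ℕ} (x : Fin k → ℝ) :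
    ‖WithLp.toLp p x‖ ^ p.toReal = ∑ i, |x i| ^ p.toReal := by
  have h1 := aux_pos p h
  have h0 : 0 < p.toReal := by linarith
  rw [PiLp.norm_eq_sum h0, one_div, Real.rpow_inv_rpow (by positivity) h0.ne']
  simp

/-- to bound a norm -/
lemma aux_norm_le {p : ℝ≥0∞} [Fact (1 ≤ p)] (h : p ≠ ⊤) {k : ℕ} (x : Fin k → ℝ) {C : ℝ}
    (hC : 0 ≤ C) (hx : ∑ i, |x i| ^ p.toReal ≤ C ^ p.toReal) : ‖WithLp.toLp p x‖ ≤ C := by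
  have h1 := aux_pos p h
  have h0 : 0 < p.toReal := by linarith
  rw [← aux_norm_pow h] at hx
  exact (Real.rpow_le_rpow_iff (norm_nonneg _) hC h0).1 hx

lemma aux_norm_le_top {k : ℕ} (x : Fin k → ℝ) {C : ℝ}
    (hC : 0 ≤ C) (hx : ∀ i, |x i| ≤ C) : ‖WithLp.toLp ⊤ x‖ ≤ C := by
  rw [PiLp.norm_eq_ciSup]
  exact Real.iSup_le (fun i => by simpa using hx i) hC

lemma aux_apply_le {p : ℝ≥0∞} [Fact (1 ≤ p)] {k : ℕ} (x : Fin k → ℝ) (i : Fin k) :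
    |x i| ≤ ‖WithLp.toLp p x‖ := by
  simpa using PiLp.norm_apply_le (WithLp.toLp p x) i

lemma aux_mono {p : ℝ≥0∞} [Fact (1 ≤ p)] {k : ℕ} (x y : Fin k → ℝ) (h : ∀ i, |x i| ≤ |y i|) :
    ‖WithLp.toLp p x‖ ≤ ‖WithLp.toLp p y‖ := by
  by_cases hp : p = ⊤
  · subst hp
    exact aux_norm_le_top _ (norm_nonneg _) fun i => (h i).trans (aux_apply_le y i)
  · have h1 := aux_pos p hp
    refine aux_norm_le hp _ (norm_nonneg _) ?_
    rw [aux_norm_pow hp]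
    exact Finset.sum_le_sum fun i _ => Real.rpow_le_rpow (abs_nonneg _) (h i) (by linarith)

lemma aux_cube {p : ℝ≥0∞} [Fact (1 ≤ p)] {k : ℕ} (x : Fin k → ℝ) {C : ℝ} (hC : 0 ≤ C)
    (h : ∀ i, |x i| ≤ C) : ‖WithLp.toLp p x‖ ≤ (k : ℝ) ^ (1 / p).toReal * C := by
  by_cases hp : p = ⊤
  · subst hp
    simpa using aux_norm_le_top _ hC h
  · have h1 := aux_pos p hp
    refine aux_norm_le hp _ (by positivity) ?_
    rw [Real.mul_rpow (by positivity) hC, ← Real.rpow_mul (by positivity), ENNReal.toReal_div]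
    rw [ENNReal.toReal_one, one_div_mul_cancel (by linarith), Real.rpow_one]
    calc ∑ i, |x i| ^ p.toReal ≤ ∑ i : Fin k, C ^ p.toReal := by
          gcongr with i _
          exact h i
      _ = _ := by simp

lemma aux_holder {p q s : ℝ≥0∞} [Fact (1 ≤ p)] [Fact (1 ≤ q)] (hpq : p < q)
    (hs : 1 / p = 1 / q + 1 / s) {k : ℕ} (x : Fin k → ℝ) :
    ‖WithLp.toLp p x‖ ≤ (k : ℝ) ^ (1 / s).toReal * ‖WithLp.toLp q x‖ := by
  by_cases hq : q = ⊤
  · subst hq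
    have : 1 / s = 1 / p := by rw [hs]; simp
    rw [this]
    exact aux_cube x (norm_nonneg _) (aux_apply_le x)
  · have hp : p ≠ ⊤ := hpq.ne_top
    have h1 := aux_pos p hp
    have h2 := aux_pos q hq
    have h12 : p.toReal < q.toReal := (ENNReal.toReal_lt_toReal hp hq).2 hpq
    have p0 : 0 < p.toReal := by linarith
    have q0 : 0 < q.toReal := by linarith
    have hs' : (1 / p).toReal = (1 / q).toReal + (1 / s).toReal := by
      rw [hs, ENNReal.toReal_add]
      · simp only [one_div, ne_eq, ENNReal.inv_eq_top]
        rintro rfl; simp at h2; linarith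
      · intro h
        rw [h] at hs
        simp only [one_div, add_top, ENNReal.inv_eq_top] at hs
        subst hs; simp at h1; linarith
    rw [ENNReal.toReal_div, ENNReal.toReal_div, ENNReal.toReal_one] at hs'
    set u := (1 / s).toReal
    rcases Nat.eq_zero_or_pos k with rfl | hk
    · have : x = 0 := Subsingleton.elim _ _
      subst this
      rw [WithLp.toLp_zero, WithLp.toLp_zero]
      simp only [norm_zero, mul_zero, le_refl]
    have hk' : (0:ℝ) < k := by exact_mod_cast hk
    have := Real.rpow_sum_le_const_mul_sum_rpow_of_nonneg (p := q.toReal / p.toReal) Finset.univ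
      (f := fun i => |x i| ^ p.toReal) ((one_le_div p0).2 h12.le) (fun i _ => by positivity)
    simp only [← aux_norm_pow hp, ← Real.rpow_mul (abs_nonneg _), ← Real.rpow_mul (norm_nonneg _),
      mul_div_cancel₀ _ p0.ne', Finset.card_univ, Fintype.card_fin] at this
    rw [← aux_norm_pow hq] at this
    have e : (k:ℝ) ^ (q.toReal / p.toReal - 1) = ((k:ℝ) ^ u) ^ q.toReal := by
      rw [← Real.rpow_mul hk'.le]
      congr 1
      have : u = 1 / p.toReal - 1 / q.toReal := by linarith
      rw [this]; field_simp
    rw [e, ← Real.mul_rpow (by positivity) (norm_nonneg _)] at this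
    exact (Real.rpow_le_rpow_iff (norm_nonneg _) (by positivity) q0).1 this

/-! volumes -/
def uB (p : ℝ≥0∞) [Fact (1 ≤ p)] (k : ℕ) : Set (Fin k → ℝ) := {x | ‖WithLp.toLp p x‖ ≤ 1}

lemma ballVolume_eq (p : ℝ≥0∞) [Fact (1 ≤ p)] (k : ℕ) : ballVolume p k = volume (uB p k) := by
  unfold ballVolume uB
  congr 1
  ext x
  constructor
  · rintro ⟨y, hy, rfl⟩
    simpa using hy
  · intro hx
    exact ⟨WithLp.toLp p x, by simpa using hx, rfl⟩

lemma uB_closed (p : ℝ≥0∞) [Fact (1 ≤ p)] (k : ℕ) : IsClosed (uB p k) := by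
  have : Continuous fun x : Fin k → ℝ => ‖WithLp.toLp p x‖ :=
    (PiLp.continuous_toLp p _).norm
  exact isClosed_le this continuous_const

lemma cube_sub (p : ℝ≥0∞) [Fact (1 ≤ p)] (k : ℕ) (hk : 0 < k) :
    closedBall (0 : Fin k → ℝ) ((k : ℝ) ^ (-(1 / p).toReal)) ⊆ uB p k := by
  have hk' : (0:ℝ) < k := by exact_mod_cast hk
  intro x hx
  rw [mem_closedBall_zero_iff] at hx
  have := aux_cube (p := p) x (C := (k : ℝ) ^ (-(1 / p).toReal)) (by positivity)
    (fun i => (norm_le_pi_norm x i).trans hx)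
  rwa [← Real.rpow_add hk', add_neg_cancel, Real.rpow_zero] at this

lemma vol_lower (p : ℝ≥0∞) [Fact (1 ≤ p)] (k : ℕ) (hk : 0 < k) :
    ENNReal.ofReal ((2 * (k : ℝ) ^ (-(1 / p).toReal)) ^ k) ≤ ballVolume p k := by
  rw [ballVolume_eq]
  refine le_trans (le_of_eq ?_) (measure_mono (cube_sub p k hk))
  rw [Real.volume_pi_closedBall _ (by positivity)]
  simp

lemma vol_lt_top (p : ℝ≥0∞) [Fact (1 ≤ p)] (k : ℕ) : ballVolume p k < ⊤ := by
  rw [ballVolume_eq]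
  refine lt_of_le_of_lt (measure_mono (?_ : _ ⊆ closedBall (0 : Fin k → ℝ) 1)) measure_closedBall_lt_top
  intro x hx
  rw [mem_closedBall_zero_iff, pi_norm_le_iff_of_nonneg zero_le_one]
  exact fun i => (aux_apply_le (p := p) x i).trans hx

lemma vol_pos (p : ℝ≥0∞) [Fact (1 ≤ p)] (k : ℕ) (hk : 0 < k) : 0 < ballVolume p k := by
  have hk' : (0:ℝ) < k := by exact_mod_cast hk
  exact lt_of_lt_of_le (by rw [ENNReal.ofReal_pos]; positivity) (vol_lower p k hk)

lemma gamma_lower (x : ℝ) (hx : 0 < x) : (x / Real.exp 1) ^ x ≤ Real.Gamma (x + 1) := by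
  rw [Real.Gamma_eq_integral (by linarith), add_sub_cancel_right]
  have hint : IntegrableOn (fun t => Real.exp (-t) * t ^ x) (Set.Ioi 0) := by
    simpa using Real.GammaIntegral_convergent (s := x + 1) (by linarith)
  calc (x / Real.exp 1) ^ x = ∫ t in Set.Ioi x, Real.exp (-t) * x ^ x := by
        rw [integral_mul_const, integral_exp_neg_Ioi, Real.div_rpow hx.le (Real.exp_pos 1).le,
          Real.exp_one_rpow, Real.exp_neg]
        field_simp
    _ ≤ ∫ t in Set.Ioi x, Real.exp (-t) * t ^ x := by
        refine setIntegral_mono_on ?_ (hint.mono_set (Set.Ioi_subset_Ioi hx.le)) measurableSet_Ioi ?_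
        · exact (integrableOn_exp_neg_Ioi x).mul_const _
        · intro t ht
          have : x < t := ht
          gcongr
    _ ≤ _ := by
        refine setIntegral_mono_set hint ?_ (Set.Ioi_subset_Ioi hx.le).eventuallyLE
        refine (ae_restrict_iff' measurableSet_Ioi).2 (ae_of_all _ fun t ht => ?_)
        have : 0 < t := ht
        simp only [Pi.zero_apply]
        positivity

lemma vol_upper (p : ℝ≥0∞) [Fact (1 ≤ p)] (hp : p ≠ ⊤) : ∃ C : ℝ, 0 < C ∧ ∀ k : ℕ, 0 < k →
    ballVolume p k ≤ ENNReal.ofReal ((C * (k : ℝ) ^ (-(1 / p).toReal)) ^ k) := by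
  have h1 := aux_pos p hp
  have p0 : 0 < p.toReal := by linarith
  have hG : 0 < Real.Gamma (1 / p.toReal + 1) := Real.Gamma_pos_of_pos (by positivity)
  refine ⟨2 * Real.Gamma (1 / p.toReal + 1) * (p.toReal * Real.exp 1) ^ (1 / p.toReal),
    by positivity, fun k hk => ?_⟩
  have hk' : (0:ℝ) < k := by exact_mod_cast hk
  have : Nonempty (Fin k) := ⟨⟨0, hk⟩⟩
  have := MeasureTheory.volume_sum_rpow_le (ι := Fin k) h1 1
  rw [ballVolume_eq]
  have e : uB p k = {x : Fin k → ℝ | (∑ i, |x i| ^ p.toReal) ^ (1 / p.toReal) ≤ 1} := by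
    ext x
    simp [uB, PiLp.norm_eq_sum p0]
  rw [e, this]
  simp only [ENNReal.ofReal_one, one_pow, one_mul, Fintype.card_fin]
  apply ENNReal.ofReal_le_ofReal
  have g := gamma_lower (k / p.toReal) (by positivity)
  have e2 : (k / p.toReal / Real.exp 1) ^ (k / p.toReal)
      = (((p.toReal * Real.exp 1) ^ (1 / p.toReal) * (k : ℝ) ^ (-(1 / p).toReal)) ^ k)⁻¹ := by
    rw [ENNReal.toReal_div, ENNReal.toReal_one, Real.rpow_neg hk'.le, ← div_eq_mul_inv,
      ← Real.div_rpow (by positivity) hk'.le, ← Real.rpow_natCast, ← Real.rpow_mul (by positivity),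
      ← Real.inv_rpow (by positivity), inv_div, div_div]
    congr 1
    field_simp
  rw [mul_assoc (2 * Real.Gamma (1 / p.toReal + 1)),
    mul_pow (2 * Real.Gamma (1 / p.toReal + 1)) (_ * _)]
  rw [e2] at g
  rw [div_le_iff₀ (Real.Gamma_pos_of_pos (by positivity)), mul_assoc]
  have hA : 0 ≤ (2 * Real.Gamma (1 / p.toReal + 1)) ^ k := by positivity
  refine le_mul_of_one_le_right hA ?_
  have hpos : 0 < ((p.toReal * Real.exp 1) ^ (1 / p.toReal) * (k : ℝ) ^ (-(1 / p).toReal)) ^ k := by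
    positivity
  rw [inv_le_iff_one_le_mul₀ hpos] at g
  linarith
lemma greedy {X : Type*} [PseudoMetricSpace X] (H : Set X) (hH : H.Nonempty) (n : ℕ) (hn : 1 ≤ n)
    (r : ℝ) (hr : 0 ≤ r) (hc : ¬ ∃ y : Fin n → X, H ⊆ ⋃ i, closedBall (y i) r) (j : ℕ) (hj : j ≤ n + 1) :
    ∃ t : Finset X, (t : Set X) ⊆ H ∧ t.card = j ∧ ∀ a ∈ t, ∀ b ∈ t, a ≠ b → r < dist a b := by
  classical
  induction j with
  | zero => exact ⟨∅, by simp⟩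
  | succ j ih =>
    obtain ⟨t, ht, hcard, hsep⟩ := ih (by omega)
    have : ∃ z ∈ H, ∀ a ∈ t, r < dist z a := by
      by_contra! hcon
      apply hc
      obtain ⟨z0, hz0⟩ := hH
      obtain ⟨a0, ha0, -⟩ := hcon z0 hz0
      refine ⟨fun i => if h : i.1 < j then (t.equivFin.symm ⟨i.1, by omega⟩).1 else a0,
        fun z hz => ?_⟩
      obtain ⟨a, ha, hza⟩ := hcon z hz
      rw [Set.mem_iUnion]
      have hlt := (t.equivFin ⟨a, ha⟩).2
      refine ⟨⟨(t.equivFin ⟨a, ha⟩).1, by omega⟩, ?_⟩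
      have hlt' : (t.equivFin ⟨a, ha⟩).1 < j := by omega
      simp only [dif_pos hlt']
      simpa using hza
    obtain ⟨z, hz, hza⟩ := this
    have hzt : z ∉ t := fun h => by
      have := hza z h
      rw [dist_self] at this
      linarith
    refine ⟨insert z t, ?_, by rw [Finset.card_insert_of_notMem hzt, hcard], ?_⟩
    · rw [Finset.coe_insert]
      exact Set.insert_subset hz ht
    · intro a ha b hb hab
      rw [Finset.mem_insert] at ha hb
      rcases ha with rfl | ha <;> rcases hb with rfl | hb
      · exact absurd rfl hab
      · exact hza b hb
      · rw [dist_comm]; exact hza a ha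
      · exact hsep a ha b hb hab

open scoped Pointwise in
lemma vol_ball (q : ℝ≥0∞) [Fact (1 ≤ q)] (k : ℕ) (a : PiLp q (fun _ : Fin k => ℝ)) (δ : ℝ)
    (hδ : 0 < δ) : volume {x : Fin k → ℝ | ‖WithLp.toLp q x - a‖ ≤ δ} =
      ENNReal.ofReal (δ ^ k) * ballVolume q k := by
  have : {x : Fin k → ℝ | ‖WithLp.toLp q x - a‖ ≤ δ} =
      (fun x => (-WithLp.ofLp a) + x) ⁻¹' (δ • uB q k) := by
    ext x
    rw [Set.mem_preimage, Set.mem_smul_set_iff_inv_smul_mem₀ hδ.ne']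
    have e : WithLp.toLp q (δ⁻¹ • (-WithLp.ofLp a + x)) = δ⁻¹ • (WithLp.toLp q x - a) := by
      ext i
      simp only [PiLp.smul_apply, PiLp.sub_apply, Pi.smul_apply, Pi.add_apply, Pi.neg_apply]
      congr 1
      ring
    simp only [uB, Set.mem_ofPred_eq]
    rw [e, norm_smul, Real.norm_of_nonneg (by positivity), inv_mul_le_iff₀ hδ, mul_one]
  rw [this, measure_preimage_add, Measure.addHaar_smul, ballVolume_eq]
  simp [abs_of_pos hδ]

lemma vol_diag (p : ℝ≥0∞) [Fact (1 ≤ p)] (k : ℕ) (a : Fin k → ℝ) (ha : ∀ i, 0 < a i) :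
    volume {x : Fin k → ℝ | ‖WithLp.toLp p (fun i => x i / a i)‖ ≤ 1} =
      ENNReal.ofReal (∏ i, a i) * ballVolume p k := by
  have : {x : Fin k → ℝ | ‖WithLp.toLp p (fun i => x i / a i)‖ ≤ 1} =
      Matrix.toLin' (Matrix.diagonal a) '' uB p k := by
    ext x
    constructor
    · intro hx
      refine ⟨fun i => x i / a i, hx, ?_⟩
      ext i
      simp [Matrix.mulVec_diagonal, mul_div_cancel₀ _ (ha i).ne']
    · rintro ⟨y, hy, rfl⟩
      have : (fun i => (Matrix.toLin' (Matrix.diagonal a)) y i / a i) = y := by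
        ext i
        simp [Matrix.mulVec_diagonal, mul_div_cancel_left₀ _ (ha i).ne']
      simp only [Set.mem_ofPred_eq]
      rw [this]; exact hy
  rw [this, Measure.addHaar_image_linearMap, LinearMap.det_toLin', Matrix.det_diagonal, ballVolume_eq,
    abs_of_pos (Finset.prod_pos fun i _ => ha i)]

lemma incl {p q s : ℝ≥0∞} [Fact (1 ≤ p)] [Fact (1 ≤ q)] (hpq : p < q)
    (hs : 1 / p = 1 / q + 1 / s) {k : ℕ} (hk : 0 < k) (τ : Fin k → ℝ) (m δ : ℝ) (hδ : 0 < δ)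
    (hm : 2 * δ ≤ m) (hτ : ∀ i, m ≤ τ i) (x w : Fin k → ℝ) (hx : ‖WithLp.toLp p x‖ ≤ 1)
    (hw : ‖WithLp.toLp q w - WithLp.toLp q (fun i => τ i * x i)‖ ≤ δ) :
    ‖WithLp.toLp p (fun i => w i / (2 * τ i + (k : ℝ) ^ (1 / s).toReal * m))‖ ≤ 1 := by
  have hk' : (0:ℝ) < k := by exact_mod_cast hk
  set K := (k : ℝ) ^ (1 / s).toReal with hK
  have hK0 : 0 < K := by positivity
  have hm0 : 0 < m := by linarith
  let y : Fin k → ℝ := fun i => w i - τ i * x i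
  have hy : ‖WithLp.toLp q y‖ ≤ δ := by
    have e : WithLp.toLp q y = WithLp.toLp q w - WithLp.toLp q (fun i => τ i * x i) := by
      ext i; rfl
    rwa [e]
  have e : WithLp.toLp p (fun i => w i / (2 * τ i + K * m)) =
      WithLp.toLp p (fun i => τ i * x i / (2 * τ i + K * m)) +
      WithLp.toLp p (fun i => y i / (2 * τ i + K * m)) := by
    ext i
    simp only [PiLp.add_apply, y]
    ring
  have n1 : ‖WithLp.toLp p (fun i => τ i * x i / (2 * τ i + K * m))‖ ≤ 1 / 2 := by
    refine (aux_mono _ ((1 / 2 : ℝ) • x) fun i => ?_).trans ?_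
    · have := hτ i
      have h0 : 0 < τ i := by linarith
      have h1 : 0 < K * m := by positivity
      rw [abs_div, abs_mul, abs_of_pos h0, abs_of_pos (by linarith : 0 < 2 * τ i + K * m),
        Pi.smul_apply, smul_eq_mul, abs_mul, abs_of_pos (by norm_num : (0:ℝ) < 1 / 2),
        div_le_iff₀ (by linarith)]
      nlinarith [abs_nonneg (x i), mul_nonneg h1.le (abs_nonneg (x i))]
    · rw [WithLp.toLp_smul, norm_smul]
      norm_num
      linarith
  have n2 : ‖WithLp.toLp p (fun i => y i / (2 * τ i + K * m))‖ ≤ 1 / 2 := by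
    refine (aux_mono _ ((1 / (K * m) : ℝ) • y) fun i => ?_).trans ?_
    · have := hτ i
      have h0 : 0 < τ i := by linarith
      have h1 : 0 < K * m := by positivity
      rw [abs_div, abs_of_pos (by linarith : 0 < 2 * τ i + K * m),
        Pi.smul_apply, smul_eq_mul, abs_mul, abs_of_pos (by positivity : (0:ℝ) < 1 / (K * m)),
        mul_comm (1 / (K * m)), mul_one_div]
      exact div_le_div_of_nonneg_left (abs_nonneg _) h1 (by linarith)
    · rw [WithLp.toLp_smul, norm_smul, Real.norm_of_nonneg (by positivity)]
      have := aux_holder hpq hs y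
      rw [← hK] at this
      have h3 : ‖WithLp.toLp p y‖ ≤ K * (m / 2) :=
        this.trans (by gcongr; linarith)
      rw [one_div, inv_mul_le_iff₀ (by positivity)]
      linarith
  rw [e]
  exact (norm_add_le _ _).trans (by linarith)

/-- the volumetric covering -/
lemma cover {p q s : ℝ≥0∞} [Fact (1 ≤ p)] [Fact (1 ≤ q)] (hpq : p < q)
    (hs : 1 / p = 1 / q + 1 / s) {k : ℕ} (hk : 0 < k) (τ : Fin k → ℝ) (m δ : ℝ) (hδ : 0 < δ)
    (hm : 2 * δ ≤ m) (hτ : ∀ i, m ≤ τ i) (n : ℕ) (hn : 1 ≤ n)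
    (hvol : (ballVolume p k / ballVolume q k).toReal *
      (∏ i, (2 * τ i + (k : ℝ) ^ (1 / s).toReal * m)) / n ≤ δ ^ k) :
    ∃ y : Fin n → PiLp q (fun _ : Fin k => ℝ),
      ∀ x : Fin k → ℝ, ‖WithLp.toLp p x‖ ≤ 1 →
        ∃ i, ‖WithLp.toLp q (fun i => τ i * x i) - y i‖ ≤ 2 * δ := by
  by_contra hcon
  set H : Set (PiLp q (fun _ : Fin k => ℝ)) :=
    (fun x : Fin k → ℝ => WithLp.toLp q (fun i => τ i * x i)) '' {x | ‖WithLp.toLp p x‖ ≤ 1}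
  have hH : H.Nonempty := by
    refine ⟨_, 0, ?_, rfl⟩
    simp only [Set.mem_ofPred_eq]
    rw [WithLp.toLp_zero, norm_zero]
    exact zero_le_one
  obtain ⟨t, htH, hcard, hsep⟩ := greedy H hH n hn (2 * δ) (by linarith) (by
    rintro ⟨y, hy⟩
    refine hcon ⟨y, fun x hx => ?_⟩
    have := hy ⟨x, hx, rfl⟩
    rw [Set.mem_iUnion] at this
    obtain ⟨i, hi⟩ := this
    exact ⟨i, by rwa [mem_closedBall, dist_eq_norm] at hi⟩) (n + 1) le_rfl
  set a : Fin k → ℝ := fun i => 2 * τ i + (k : ℝ) ^ (1 / s).toReal * m with ha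
  have hk' : (0:ℝ) < k := by exact_mod_cast hk
  have hm0 : 0 < m := by linarith
  have ha0 : ∀ i, 0 < a i := fun i => by
    have := hτ i
    have h2 : 0 < (k : ℝ) ^ (1 / s).toReal * m := by positivity
    simp only [ha]; linarith
  let S : PiLp q (fun _ : Fin k => ℝ) → Set (Fin k → ℝ) :=
    fun b => {x : Fin k → ℝ | ‖WithLp.toLp q x - b‖ ≤ δ}
  have hSm : ∀ b, MeasurableSet (S b) := fun b => by
    have : Continuous fun x : Fin k → ℝ => ‖WithLp.toLp q x - b‖ :=
      ((PiLp.continuous_toLp q _).sub continuous_const).norm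
    exact (isClosed_le this continuous_const).measurableSet
  have hun : volume (⋃ b ∈ t, S b) = ∑ b ∈ t, volume (S b) := by
    refine measure_biUnion_finset ?_ fun b _ => hSm b
    intro b hb c hc hbc
    refine Set.disjoint_left.2 fun x hxb hxc => ?_
    have h1 := hsep b hb c hc hbc
    have h2 := dist_triangle_left b c (WithLp.toLp q x)
    rw [dist_eq_norm (WithLp.toLp q x), dist_eq_norm (WithLp.toLp q x)] at h2
    have h3 : ‖WithLp.toLp q x - b‖ ≤ δ := hxb
    have h4 : ‖WithLp.toLp q x - c‖ ≤ δ := hxc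
    linarith
  have hsub : (⋃ b ∈ t, S b) ⊆ {x : Fin k → ℝ | ‖WithLp.toLp p (fun i => x i / a i)‖ ≤ 1} := by
    intro w hw
    simp only [Set.mem_iUnion] at hw
    obtain ⟨b, hb, hw⟩ := hw
    obtain ⟨x, hx, rfl⟩ := htH hb
    exact incl hpq hs hk τ m δ hδ hm hτ x w hx hw
  have hle := measure_mono (μ := volume) hsub
  rw [hun, vol_diag p k a ha0, Finset.sum_congr rfl fun b _ => vol_ball q k b δ hδ,
    Finset.sum_const, hcard] at hle
  have hVp := (vol_lt_top p k).ne
  have hVq := (vol_lt_top q k).ne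
  have hVq0 := ENNReal.toReal_pos (vol_pos q k hk).ne' hVq
  have hle' := ENNReal.toReal_mono (ENNReal.mul_ne_top ENNReal.ofReal_ne_top hVp) hle
  have hprod : 0 < ∏ i, a i := Finset.prod_pos fun i _ => ha0 i
  simp only [nsmul_eq_mul, ENNReal.toReal_mul, ENNReal.toReal_natCast] at hle'
  rw [ENNReal.toReal_ofReal (by positivity), ENNReal.toReal_ofReal hprod.le] at hle'
  have hn0 : (0:ℝ) < n := by exact_mod_cast hn
  rw [ENNReal.toReal_div, div_le_iff₀ hn0, div_mul_eq_mul_div, div_le_iff₀ hVq0] at hvol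
  push_cast at hle'
  have : 0 < δ ^ k * (ballVolume q k).toReal := by positivity
  nlinarith
/-- diagonal domination -/
lemma seq_dom {p q : ℝ≥0∞} [Fact (1 ≤ p)] [Fact (1 ≤ q)] (hpq : p < q)
    (x : lp (fun _ : ℕ => ℝ) p) (hx : ‖x‖ ≤ 1) (v : lp (fun _ : ℕ => ℝ) q) (C : ℝ) (hC : 0 ≤ C)
    (h : ∀ i, |v i| ≤ C * |x i|) : ‖v‖ ≤ C := by
  have hp : p ≠ ⊤ := hpq.ne_top
  have h1 := aux_pos p hp
  have p0 : p ≠ 0 := by rintro rfl; simp at h1; linarith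
  have hx1 : ∀ i, |x i| ≤ 1 := fun i => (lp.norm_apply_le_norm p0 x i).trans hx
  by_cases hq : q = ⊤
  · subst hq
    refine lp.norm_le_of_forall_le hC fun i => (h i).trans ?_
    exact mul_le_of_le_one_right hC (hx1 i)
  · have h2 := aux_pos q hq
    have h12 : p.toReal < q.toReal := (ENNReal.toReal_lt_toReal hp hq).2 hpq
    refine lp.norm_le_of_forall_sum_le (by linarith) hC fun t => ?_
    calc ∑ i ∈ t, ‖v i‖ ^ q.toReal ≤ ∑ i ∈ t, C ^ q.toReal * ‖x i‖ ^ p.toReal := by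
          refine Finset.sum_le_sum fun i _ => ?_
          calc ‖v i‖ ^ q.toReal ≤ (C * |x i|) ^ q.toReal :=
                Real.rpow_le_rpow (norm_nonneg _) (h i) (by linarith)
            _ = C ^ q.toReal * |x i| ^ q.toReal := Real.mul_rpow hC (abs_nonneg _)
            _ ≤ _ := by
                refine mul_le_mul_of_nonneg_left ?_ (by positivity)
                exact Real.rpow_le_rpow_of_exponent_ge' (abs_nonneg _) (hx1 i) (by linarith) h12.le
      _ = C ^ q.toReal * ∑ i ∈ t, ‖x i‖ ^ p.toReal := by rw [Finset.mul_sum]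
      _ ≤ C ^ q.toReal * 1 := by
          refine mul_le_mul_of_nonneg_left ?_ (by positivity)
          refine (lp.sum_rpow_le_norm_rpow (by linarith) x t).trans ?_
          exact Real.rpow_le_one (norm_nonneg _) hx (by linarith)
      _ = _ := mul_one _

noncomputable def ext0 (q : ℝ≥0∞) {k : ℕ} (z : Fin k → ℝ) : lp (fun _ : ℕ => ℝ) q :=
  ⟨fun j => if h : j < k then z ⟨j, h⟩ else 0, by
    refine (memℓp_zero ?_).of_exponent_ge zero_le
    refine (Set.finite_lt_nat k).subset ?_
    intro j hj
    by_contra h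
    exact hj (dif_neg h)⟩

lemma ext0_apply (q : ℝ≥0∞) {k : ℕ} (z : Fin k → ℝ) (j : ℕ) :
    ext0 q z j = if h : j < k then z ⟨j, h⟩ else 0 := rfl

lemma ext0_norm (q : ℝ≥0∞) [Fact (1 ≤ q)] {k : ℕ} (z : Fin k → ℝ) :
    ‖ext0 q z‖ ≤ ‖WithLp.toLp q z‖ := by
  by_cases hq : q = ⊤
  · subst hq
    refine lp.norm_le_of_forall_le (norm_nonneg _) fun j => ?_
    rw [ext0_apply]
    split_ifs with h
    · exact aux_apply_le z _
    · simp
  · have h2 := aux_pos q hq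
    have q0 : q.toReal ≠ 0 := by linarith
    refine lp.norm_le_of_forall_sum_le (by linarith) (norm_nonneg _) fun t => ?_
    rw [aux_norm_pow hq]
    calc ∑ j ∈ t, ‖ext0 q z j‖ ^ q.toReal ≤ ∑ j ∈ t ∪ Finset.range k, ‖ext0 q z j‖ ^ q.toReal :=
          Finset.sum_le_sum_of_subset_of_nonneg Finset.subset_union_left fun _ _ _ => by positivity
      _ = ∑ j ∈ Finset.range k, ‖ext0 q z j‖ ^ q.toReal := by
          symm
          refine Finset.sum_subset Finset.subset_union_right fun j _ hj => ?_
          rw [ext0_apply, dif_neg (by simpa using hj), norm_zero, Real.zero_rpow q0]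
      _ = _ := by
          rw [Finset.sum_range]
          refine Finset.sum_congr rfl fun i _ => ?_
          rw [ext0_apply, dif_pos i.2]; rfl
      _ ≤ _ := le_rfl

lemma head_norm {p : ℝ≥0∞} [Fact (1 ≤ p)] (hp : p ≠ ⊤) (x : lp (fun _ : ℕ => ℝ) p) (hx : ‖x‖ ≤ 1)
    (k : ℕ) : ‖WithLp.toLp p (fun i : Fin k => x i)‖ ≤ 1 := by
  have h1 := aux_pos p hp
  refine aux_norm_le hp _ zero_le_one ?_
  have := lp.sum_rpow_le_norm_rpow (by linarith) x (Finset.range k)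
  rw [Finset.sum_range] at this
  exact this.trans (Real.rpow_le_rpow (norm_nonneg _) hx (by linarith))

lemma sup_bdd {p q s : ℝ≥0∞} [Fact (1 ≤ p)] [Fact (1 ≤ q)]
    (hpq : p < q) (hs : 1 / p = 1 / q + 1 / s)
    (σ : ℕ → ℝ) (hσpos : ∀ k, 0 < σ k) (hσanti : Antitone σ) (n : ℕ) (hn : 1 ≤ n) :
    BddAbove (Set.range fun k : ℕ =>
          ((ballVolume p (k + 1) / ballVolume q (k + 1)).toReal *
            (∏ i ∈ Finset.range (k + 1),
              (2 * σ i + (k + 1 : ℝ) ^ (1 / s).toReal * σ k)) / n) ^ (1 / (k + 1 : ℝ))) := by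
  have hp : p ≠ ⊤ := hpq.ne_top
  obtain ⟨C, hC, hup⟩ := vol_upper p hp
  have hs' : (1 / p).toReal = (1 / q).toReal + (1 / s).toReal := by
    have q0 : q ≠ 0 := fun h => by rw [h] at hpq; simp at hpq
    have p0 : p ≠ 0 := fun h => by
      have := (inferInstance : Fact (1 ≤ p)).out
      rw [h] at this; simp at this
    rw [hs, ENNReal.toReal_add]
    · simpa using q0
    · intro h
      rw [h] at hs
      simp only [one_div, add_top, ENNReal.inv_eq_top] at hs
      exact p0 hs
  refine ⟨C / 2 * (3 * σ 0), ?_⟩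
  rintro _ ⟨k, rfl⟩
  simp only
  have hk : (0:ℝ) < (k:ℝ) + 1 := by positivity
  have hk1 : (1:ℝ) ≤ (k:ℝ) + 1 := by linarith [(Nat.cast_nonneg k : (0:ℝ) ≤ k)]
  have hn1 : (1:ℝ) ≤ n := by exact_mod_cast hn
  set K := (k + 1 : ℝ) ^ (1 / s).toReal with hK
  have hK1 : 1 ≤ K := Real.one_le_rpow hk1 ENNReal.toReal_nonneg
  have hprod : (∏ i ∈ Finset.range (k + 1), (2 * σ i + K * σ k)) ≤ (3 * K * σ 0) ^ (k + 1) := by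
    rw [← Finset.card_range (k + 1), ← Finset.prod_const, Finset.card_range]
    refine Finset.prod_le_prod (fun i _ => ?_) fun i _ => ?_
    · have := hσpos i; have := hσpos k; positivity
    · have h1 := hσanti (Nat.zero_le i)
      have h2 := hσanti (Nat.zero_le k)
      have := hσpos 0
      nlinarith
  have hprod0 : 0 ≤ (∏ i ∈ Finset.range (k + 1), (2 * σ i + K * σ k)) :=
    Finset.prod_nonneg fun i _ => by have := hσpos i; have := hσpos k; positivity
  have hratio : (ballVolume p (k + 1) / ballVolume q (k + 1)).toReal ≤ (C / 2 * K⁻¹) ^ (k + 1) := by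
    have u := ENNReal.toReal_mono ENNReal.ofReal_ne_top (hup (k + 1) k.succ_pos)
    have l := ENNReal.toReal_mono (vol_lt_top q (k + 1)).ne (vol_lower q (k + 1) k.succ_pos)
    rw [ENNReal.toReal_ofReal (by positivity)] at u l
    push_cast at u l
    rw [ENNReal.toReal_div]
    refine (div_le_div₀ (by positivity) u (by positivity) l).trans (le_of_eq ?_)
    rw [← div_pow]
    congr 1
    rw [hs', neg_add, Real.rpow_add hk, hK, Real.rpow_neg hk.le (1 / s).toReal]
    have : (k + 1 : ℝ) ^ (-(1 / q).toReal) ≠ 0 := by positivity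
    field_simp
  have hσ0 := hσpos 0
  have key : (ballVolume p (k + 1) / ballVolume q (k + 1)).toReal *
            (∏ i ∈ Finset.range (k + 1), (2 * σ i + K * σ k)) / n
            ≤ (C / 2 * (3 * σ 0)) ^ (k + 1) := by
    refine (div_le_self (by positivity) hn1).trans ?_
    refine (mul_le_mul hratio hprod hprod0 (by positivity)).trans (le_of_eq ?_)
    rw [← mul_pow]
    congr 1
    field_simp
  calc _ ≤ ((C / 2 * (3 * σ 0)) ^ (k + 1)) ^ (1 / (k + 1 : ℝ)) :=
        Real.rpow_le_rpow (by positivity) key (by positivity)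
    _ = _ := by
        have := Real.pow_rpow_inv_natCast (x := C / 2 * (3 * σ 0)) (n := k + 1) (by positivity)
          k.succ_ne_zero
        push_cast at this
        rw [one_div]; exact this

/-- **Lemma 2.5 (upper bound for `p < q`, explicit constants).**
Let `1 ≤ p < q ≤ ∞` with `1/p = 1/q + 1/s` and let `σ` be a non-increasing sequence of
positive reals tending to zero (here `σ k` denotes the `(k+1)`-st term `σ_{k+1}` of the
paper).  Then for all `n ≥ 1` the diagonal operator `D_σ : ℓ_p → ℓ_q` satisfies
`e_n(D_σ) ≤ 4 ⬝ sup_{k ≥ 1} ((λ^k(B_{ℓ_p^k})/λ^k(B_{ℓ_q^k}))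
(2σ_1 + k^{1/s} σ_k)⋯(2σ_k + k^{1/s} σ_k)/n)^{1/k}`. -/
theorem statement8 (p q s : ℝ≥0∞) [Fact (1 ≤ p)] [Fact (1 ≤ q)]
    (hpq : p < q) (hs : 1 / p = 1 / q + 1 / s)
    (σ : ℕ → ℝ) (hσpos : ∀ k, 0 < σ k) (hσanti : Antitone σ)
    (hσlim : Tendsto σ atTop (nhds 0))
    (D : lp (fun _ : ℕ => ℝ) p →L[ℝ] lp (fun _ : ℕ => ℝ) q)
    (hD : ∀ (x : lp (fun _ : ℕ => ℝ) p) (k : ℕ), D x k = σ k * x k) :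
    ∀ n : ℕ, 1 ≤ n →
      entropyNumber n (D '' Metric.closedBall 0 1) ≤
        4 * ⨆ k : ℕ,
          ((ballVolume p (k + 1) / ballVolume q (k + 1)).toReal *
            (∏ i ∈ Finset.range (k + 1),
              (2 * σ i + (k + 1 : ℝ) ^ (1 / s).toReal * σ k)) / n) ^ (1 / (k + 1 : ℝ)) := by
  intro n hn
  have hp : p ≠ ⊤ := hpq.ne_top
  set f : ℕ → ℝ := fun k => ((ballVolume p (k + 1) / ballVolume q (k + 1)).toReal *
            (∏ i ∈ Finset.range (k + 1),
              (2 * σ i + (k + 1 : ℝ) ^ (1 / s).toReal * σ k)) / n) ^ (1 / (k + 1 : ℝ)) with hf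
  have hbdd : BddAbove (Set.range f) := sup_bdd hpq hs σ hσpos hσanti n hn
  set δ : ℝ := ⨆ k, f k with hδdef
  have hn0 : (0:ℝ) < n := by exact_mod_cast hn
  have hbase : ∀ k : ℕ, 0 < (ballVolume p (k + 1) / ballVolume q (k + 1)).toReal *
            (∏ i ∈ Finset.range (k + 1),
              (2 * σ i + (k + 1 : ℝ) ^ (1 / s).toReal * σ k)) / n := fun k => by
    have h1 : 0 < (ballVolume p (k + 1) / ballVolume q (k + 1)).toReal :=
      ENNReal.toReal_pos (ENNReal.div_pos (vol_pos p _ k.succ_pos).ne' (vol_lt_top q _).ne).ne'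
        (ENNReal.div_lt_top (vol_lt_top p _).ne (vol_pos q _ k.succ_pos).ne').ne
    have h2 : 0 < ∏ i ∈ Finset.range (k + 1), (2 * σ i + (k + 1 : ℝ) ^ (1 / s).toReal * σ k) :=
      Finset.prod_pos fun i _ => by have := hσpos i; have := hσpos k; positivity
    positivity
  have hδ : 0 < δ := lt_of_lt_of_le (Real.rpow_pos_of_pos (hbase 0) _) (le_ciSup hbdd 0)
  have hex : ∃ k, σ k ≤ 2 * δ := by
    have := (hσlim.eventually (gt_mem_nhds (by linarith : (0:ℝ) < 2 * δ))).exists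
    obtain ⟨k, hk⟩ := this
    exact ⟨k, hk.le⟩
  refine csInf_le ⟨0, fun ε hε => hε.1.le⟩ ⟨by linarith, ?_⟩
  classical
  set k := Nat.find hex with hkdef
  have hk : σ k ≤ 2 * δ := Nat.find_spec hex
  -- a finite dimensional covering
  have hcov : ∃ y : Fin n → PiLp q (fun _ : Fin k => ℝ),
      ∀ x : Fin k → ℝ, ‖WithLp.toLp p x‖ ≤ 1 →
        ∃ i, ‖WithLp.toLp q (fun i : Fin k => σ i * x i) - y i‖ ≤ 2 * δ := by
    rcases hk0 : k with _ | m
    · refine ⟨fun _ => 0, fun x _ => ⟨⟨0, hn⟩, ?_⟩⟩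
      rw [Subsingleton.elim (WithLp.toLp q (fun i : Fin 0 => σ i * x i) - 0) 0, norm_zero]
      linarith
    · have hm : 2 * δ < σ m := by
        by_contra! h
        have := Nat.find_min' hex h
        omega
      refine cover hpq hs m.succ_pos (fun i : Fin (m + 1) => σ i) (σ m) δ hδ hm.le
        (fun i => hσanti (by omega)) n hn ?_
      have h1 : f m ≤ δ := le_ciSup hbdd m
      have h2 := pow_le_pow_left₀ (Real.rpow_pos_of_pos (hbase m) _).le h1 (m + 1)
      have h3 := Real.rpow_inv_natCast_pow (hbase m).le m.succ_ne_zero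
      rw [Finset.prod_range] at h3
      rw [Finset.prod_range, one_div (m + 1 : ℝ)] at h2
      push_cast at h2 h3 ⊢
      rwa [h3] at h2
  obtain ⟨y, hy⟩ := hcov
  refine ⟨fun i => ext0 q (WithLp.ofLp (y i)), ?_⟩
  rintro _ ⟨x, hx, rfl⟩
  rw [mem_closedBall_zero_iff] at hx
  obtain ⟨i, hi⟩ := hy _ (head_norm hp x hx k)
  rw [Set.mem_iUnion]
  refine ⟨i, ?_⟩
  rw [mem_closedBall, dist_eq_norm]
  set hd : Fin k → ℝ := fun j => σ j * x j
  have e : D x - ext0 q (WithLp.ofLp (y i)) =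
      ext0 q (hd - WithLp.ofLp (y i)) + (D x - ext0 q hd) := by
    ext j
    simp only [lp.coeFn_add, lp.coeFn_sub, Pi.add_apply, Pi.sub_apply, ext0_apply]
    split_ifs <;> ring
  have n1 : ‖ext0 q (hd - WithLp.ofLp (y i))‖ ≤ 2 * δ := (ext0_norm q _).trans hi
  have n2 : ‖D x - ext0 q hd‖ ≤ 2 * δ := by
    refine seq_dom hpq x hx _ _ (by linarith) fun j => ?_
    simp only [lp.coeFn_sub, Pi.sub_apply, ext0_apply, hD]
    split_ifs with h
    · simp only [hd, sub_self, abs_zero]; positivity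
    · rw [sub_zero, abs_mul, abs_of_pos (hσpos j)]
      gcongr
      exact (hσanti (by omega)).trans hk
  rw [e]
  exact (norm_add_le _ _).trans (by linarith)
end

section
/- Let 1 ≤ q < p ≤ ∞ with 1/q = 1/p + 1/r, let σ = (σ_k)_{k≥1} be a non-increasing sequence of positive real numbers with σ_k → 0 and ∑_{k≥1} σ_k^r < ∞, and let τ_k = (∑_{n≥k} σ_n^r)^{1/r} be the tail sequence. Then for all n ≥ 1 the n-th entropy number of the diagonal operator D_σ : ℓ_p → ℓ_q satisfies e_n(D_σ) ≤ 4 · sup_{k≥1} ( (τ_k + 2 k^{1/r} σ_1)·(τ_k + 2 k^{1/r} σ_2)·…·(τ_k + 2 k^{1/r} σ_k) / n )^{1/k}. -/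
open Metric Filter
open scoped ENNReal

/-- The tail sequence `τ_{k+1} = (∑_{n ≥ k} σ_n^r)^{1/r}` of a (0-indexed) sequence `σ`. -/
noncomputable def tailSeq (r : ℝ) (σ : ℕ → ℝ) (k : ℕ) : ℝ :=
  (∑' j : ℕ, if k ≤ j then σ j ^ r else 0) ^ (1 / r)

def PB9 (p : ℝ≥0∞) {ι : Type*} (s : Finset ι) (x : ι → ℝ) (B : ℝ) : Prop :=
  (p ≠ ∞ → ∑ i ∈ s, |x i| ^ p.toReal ≤ B ^ p.toReal) ∧ (p = ∞ → ∀ i ∈ s, |x i| ≤ B)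

lemma PB9.mono {p : ℝ≥0∞} {ι : Type*} {s : Finset ι} {x y : ι → ℝ} {B : ℝ}
    (h : PB9 p s x B) (hxy : ∀ i ∈ s, |y i| ≤ |x i|) : PB9 p s y B := by
  refine ⟨fun hp => ?_, fun hp i hi => (hxy i hi).trans (h.2 hp i hi)⟩
  refine le_trans (Finset.sum_le_sum fun i hi => ?_) (h.1 hp)
  exact Real.rpow_le_rpow (abs_nonneg _) (hxy i hi) ENNReal.toReal_nonneg

lemma rr9 {p q r : ℝ≥0∞} (h1q : 1 ≤ q)
    (hqp : q < p) (hr : 1 / q = 1 / p + 1 / r) : 1 ≤ r ∧ r ≠ ∞ := by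
  have hqt : q ≠ ∞ := (lt_of_lt_of_le hqp le_top).ne
  have hq0 : q ≠ 0 := (zero_lt_one.trans_le h1q).ne'
  constructor
  · have h : 1 / r ≤ 1 / q := by rw [hr]; exact le_add_self
    rw [one_div, one_div, ENNReal.inv_le_inv] at h
    exact h1q.trans h
  · rintro rfl
    simp at hr
    exact hqp.ne hr

lemma holder9 {p q r : ℝ≥0∞} (h1p : 1 ≤ p) (h1q : 1 ≤ q)
    (hqp : q < p) (hr : 1 / q = 1 / p + 1 / r) {ι : Type*} (s : Finset ι) (a x : ι → ℝ)
    (A B : ℝ) (hA : 0 ≤ A) (hB : 0 ≤ B) (ha : ∀ i, 0 ≤ a i)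
    (hx : PB9 p s x B) (hs : ∑ i ∈ s, a i ^ r.toReal ≤ A ^ r.toReal) :
    ∑ i ∈ s, |a i * x i| ^ q.toReal ≤ (A * B) ^ q.toReal := by
  have hqt : q ≠ ∞ := (lt_of_lt_of_le hqp le_top).ne
  have hq0 : q ≠ 0 := (zero_lt_one.trans_le h1q).ne'
  obtain ⟨h1r, hrt⟩ := rr9 h1q hqp hr
  have hr0 : r ≠ 0 := (zero_lt_one.trans_le h1r).ne'
  have qpos : 0 < q.toReal := ENNReal.toReal_pos hq0 hqt
  have rpos : 0 < r.toReal := ENNReal.toReal_pos hr0 hrt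
  by_cases hp : p = ∞
  · subst hp
    have hqr : q = r := by simpa using hr
    subst hqr
    rw [Real.mul_rpow hA hB]
    calc ∑ i ∈ s, |a i * x i| ^ q.toReal ≤ ∑ i ∈ s, a i ^ q.toReal * B ^ q.toReal := by
          refine Finset.sum_le_sum fun i hi => ?_
          rw [← Real.mul_rpow (ha i) hB, abs_mul, abs_of_nonneg (ha i)]
          exact Real.rpow_le_rpow (by have := ha i; positivity)
            (mul_le_mul_of_nonneg_left (hx.2 rfl i hi) (ha i)) qpos.le
      _ ≤ _ := by
          rw [← Finset.sum_mul]
          exact mul_le_mul_of_nonneg_right hs (by positivity)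
  · have hp0 : p ≠ 0 := (zero_lt_one.trans_le h1p).ne'
    have ppos : 0 < p.toReal := ENNReal.toReal_pos hp0 hp
    have e : q.toReal⁻¹ = p.toReal⁻¹ + r.toReal⁻¹ := by
      have := congrArg ENNReal.toReal hr
      rw [ENNReal.toReal_add (by simpa using hp0) (by simpa using hr0)] at this
      simpa using this
    have ht : Real.HolderTriple r.toReal p.toReal q.toReal := ⟨by rw [e]; ring, rpos, ppos⟩
    refine (Real.Lr_rpow_le_Lp_mul_Lq s a x ht).trans ?_
    have e1 : ∑ i ∈ s, |a i| ^ r.toReal = ∑ i ∈ s, a i ^ r.toReal :=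
      Finset.sum_congr rfl fun i _ => by rw [abs_of_nonneg (ha i)]
    rw [e1, Real.mul_rpow hA hB]
    have key : ∀ (S A t : ℝ), 0 ≤ S → 0 ≤ A → 0 < t → S ≤ A ^ t → 
        S ^ (q.toReal / t) ≤ A ^ q.toReal := by
      intro S A t hS hA ht h
      refine (Real.rpow_le_rpow hS h (by positivity)).trans (le_of_eq ?_)
      rw [← Real.rpow_mul hA]
      congr 1
      field_simp
    have n1 : 0 ≤ ∑ i ∈ s, a i ^ r.toReal :=
      Finset.sum_nonneg fun i _ => Real.rpow_nonneg (ha i) _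
    have n2 : 0 ≤ ∑ i ∈ s, |x i| ^ p.toReal :=
      Finset.sum_nonneg fun i _ => Real.rpow_nonneg (abs_nonneg _) _
    exact mul_le_mul (key _ _ _ n1 hA rpos hs) (key _ _ _ n2 hB ppos (hx.1 hp))
      (by positivity) (by positivity)

lemma pilp9 (p : ℝ≥0∞) [Fact (1 ≤ p)] {m : ℕ} (v : Fin m → ℝ) (B : ℝ) (hB : 0 ≤ B) :
    ‖WithLp.toLp p v‖ ≤ B ↔ PB9 p Finset.univ v B := by
  by_cases hp : p = ∞
  · subst hp
    rw [PiLp.norm_toLp, pi_norm_le_iff_of_nonneg hB]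
    simp [PB9]
  · have hp0 : p ≠ 0 := (zero_lt_one.trans_le (Fact.out : 1 ≤ p)).ne'
    have ppos : 0 < p.toReal := ENNReal.toReal_pos hp0 hp
    rw [PiLp.norm_eq_sum ppos]
    have n2 : 0 ≤ ∑ i, |v i| ^ p.toReal :=
      Finset.sum_nonneg fun i _ => Real.rpow_nonneg (abs_nonneg _) _
    rw [one_div]
    simp only [Real.norm_eq_abs]
    rw [Real.rpow_inv_le_iff_of_pos n2 hB ppos]
    simp [PB9, hp]

lemma lp9 (p : ℝ≥0∞) [Fact (1 ≤ p)] (x : lp (fun _ : ℕ => ℝ) p) (B : ℝ) (hB : ‖x‖ ≤ B)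
    (s : Finset ℕ) : PB9 p s x B := by
  have hp0 : p ≠ 0 := (zero_lt_one.trans_le (Fact.out : 1 ≤ p)).ne'
  refine ⟨fun hp => ?_, fun hp i _ => ?_⟩
  · have ppos : 0 < p.toReal := ENNReal.toReal_pos hp0 hp
    exact (lp.sum_rpow_le_norm_rpow ppos x s).trans
      (Real.rpow_le_rpow (norm_nonneg _) hB ppos.le)
  · exact (lp.norm_apply_le_norm hp0 x i).trans hB

lemma fin9 (p : ℝ≥0∞) (m : ℕ) (x : ℕ → ℝ) (B : ℝ) :
    PB9 p (Finset.univ : Finset (Fin m)) (fun i => x i) B ↔ PB9 p (Finset.range m) x B := by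
  unfold PB9
  rw [Finset.sum_range (fun i => |x i| ^ p.toReal)]
  refine and_congr Iff.rfl (imp_congr Iff.rfl ⟨fun h i hi => ?_, fun h i _ => ?_⟩)
  · exact h ⟨i, Finset.mem_range.1 hi⟩ (Finset.mem_univ _)
  · exact h i (Finset.mem_range.2 i.2)

lemma cover9 {α : Type*} (A : Set α) (R : α → α → Prop) (hrefl : ∀ x, R x x)
    (hsymm : ∀ x y, R x y → R y x) (n : ℕ)
    (h : ∀ s : Finset α, (∀ x ∈ s, x ∈ A) → (∀ x ∈ s, ∀ y ∈ s, x ≠ y → ¬ R x y) → s.card ≤ n) :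
    ∃ s : Finset α, s.card ≤ n ∧ (∀ x ∈ s, x ∈ A) ∧ ∀ y ∈ A, ∃ z ∈ s, R y z := by
  classical
  by_contra hc
  push Not at hc
  have : ∀ k ≤ n + 1, ∃ s : Finset α, s.card = k ∧ (∀ x ∈ s, x ∈ A) ∧
      (∀ x ∈ s, ∀ y ∈ s, x ≠ y → ¬ R x y) := by
    intro k
    induction k with
    | zero => intro _; exact ⟨∅, by simp⟩
    | succ k ih =>
      intro hk
      obtain ⟨s, hs, hsA, hsR⟩ := ih (by omega)
      obtain ⟨y, hyA, hy⟩ := hc s (by omega) hsA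
      have hys : y ∉ s := fun h' => hy y h' (hrefl y)
      refine ⟨insert y s, by rw [Finset.card_insert_of_notMem hys, hs], ?_, ?_⟩
      · intro x hx
        rcases Finset.mem_insert.1 hx with rfl | hx
        exacts [hyA, hsA x hx]
      · intro x hx z hz hxz
        rcases Finset.mem_insert.1 hx with hx | hx <;> rcases Finset.mem_insert.1 hz with hz | hz
        · exact absurd (hx.trans hz.symm) hxz
        · rw [hx]; exact hy z hz
        · rw [hz]; exact fun h1 => hy x hx (hsymm _ _ h1)
        · exact hsR x hx z hz hxz
  obtain ⟨s, hs, hsA, hsR⟩ := this (n + 1) le_rfl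
  have := h s hsA hsR
  omega

open MeasureTheory in
open scoped Pointwise in
lemma vol9 (p : ℝ≥0∞) [Fact (1 ≤ p)] {m : ℕ} (δ : ℝ) (hδ : 0 < δ) (a : Fin m → ℝ)
    (ha : ∀ i, 0 ≤ a i) (s : Finset (Fin m → ℝ))
    (hsep : ∀ x ∈ s, ∀ y ∈ s, x ≠ y → ¬ ‖WithLp.toLp p (x - y)‖ ≤ 2 * δ)
    (hsub : ∀ y ∈ s, ∀ z : Fin m → ℝ, ‖WithLp.toLp p z‖ ≤ 1 →
      ∃ w : Fin m → ℝ, ‖WithLp.toLp p w‖ ≤ 1 ∧ ∀ i, y i + δ * z i = a i * w i) :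
    (s.card : ℝ) * δ ^ m ≤ ∏ i, a i := by
  classical
  set K : Set (Fin m → ℝ) := {x | ‖WithLp.toLp p x‖ ≤ 1} with hK
  have hcont : Continuous fun x : Fin m → ℝ => ‖WithLp.toLp p x‖ :=
    (PiLp.continuous_toLp p _).norm
  have hKclosed : IsClosed K := isClosed_le hcont continuous_const
  have hKpos : volume K ≠ 0 := by
    have hopen : IsOpen {x : Fin m → ℝ | ‖WithLp.toLp p x‖ < 1} :=
      isOpen_lt hcont continuous_const
    have := hopen.measure_pos volume ⟨0, by simp⟩
    exact (this.trans_le (measure_mono fun x (hx : ‖WithLp.toLp p x‖ < 1) => (show ‖WithLp.toLp p x‖ ≤ 1 from hx.le))).ne'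
  have hKfin : volume K ≠ ∞ := by
    have : K ⊆ Metric.closedBall 0 1 := by
      intro x hx
      rw [mem_closedBall_zero_iff, pi_norm_le_iff_of_nonneg zero_le_one]
      intro i
      exact (PiLp.norm_apply_le (WithLp.toLp p x) i).trans hx
    exact ((measure_mono this).trans_lt measure_closedBall_lt_top).ne
  let f : (Fin m → ℝ) →ₗ[ℝ] (Fin m → ℝ) := Matrix.toLin' (Matrix.diagonal a)
  have hf : ∀ x i, f x i = a i * x i := by
    intro x i
    simp [f, Matrix.mulVec_diagonal]
  have hfv : volume (f '' K) = ENNReal.ofReal (∏ i, a i) * volume K := by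
    rw [Measure.addHaar_image_linearMap]
    simp only [f, LinearMap.det_toLin', Matrix.det_diagonal]
    rw [abs_of_nonneg (Finset.prod_nonneg fun i _ => ha i)]
  let T : (Fin m → ℝ) → Set (Fin m → ℝ) := fun y => {w | ‖WithLp.toLp p (w - y)‖ ≤ δ}
  have hTmeas : ∀ y, MeasurableSet (T y) := by
    intro y
    exact (isClosed_le (hcont.comp (continuous_id.sub continuous_const))
      continuous_const).measurableSet
  have hTeq : ∀ y, ∀ w ∈ T y, ∃ z ∈ K, w = y + δ • z := by
    intro y w hw
    refine ⟨δ⁻¹ • (w - y), ?_, ?_⟩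
    · change ‖WithLp.toLp p (δ⁻¹ • (w - y))‖ ≤ 1
      rw [WithLp.toLp_smul, norm_smul, norm_inv, Real.norm_of_nonneg hδ.le,
        inv_mul_le_iff₀ hδ, mul_one]
      exact hw
    · rw [smul_inv_smul₀ hδ.ne']; abel
  have hTvol : ∀ y, ENNReal.ofReal (δ ^ m) * volume K ≤ volume (T y) := by
    intro y
    have h1 : volume (δ • K) = ENNReal.ofReal (δ ^ m) * volume K := by
      rw [Measure.addHaar_smul, abs_of_pos (by positivity)]
      simp
    rw [← h1, ← measure_preimage_add_right volume (-y) (δ • K)]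
    refine measure_mono ?_
    rintro w ⟨z, hz, hzw⟩
    change ‖WithLp.toLp p (w - y)‖ ≤ δ
    have hzw' : w - y = δ • z := by rw [sub_eq_add_neg]; exact hzw.symm
    rw [hzw', WithLp.toLp_smul, norm_smul, Real.norm_of_nonneg hδ.le]
    have : ‖WithLp.toLp p z‖ ≤ 1 := hz
    nlinarith
  have hdisj : Set.PairwiseDisjoint (↑s) T := by
    intro x hx y hy hxy
    rw [Function.onFun, Set.disjoint_left]
    intro w hwx hwy
    refine hsep x hx y hy hxy ?_
    have e : WithLp.toLp p (x - y) = WithLp.toLp p (w - y) - WithLp.toLp p (w - x) := by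
      rw [← WithLp.toLp_sub]; congr 1; abel
    rw [e]
    have h1 : ‖WithLp.toLp p (w - x)‖ ≤ δ := hwx
    have h2 : ‖WithLp.toLp p (w - y)‖ ≤ δ := hwy
    linarith [norm_sub_le (WithLp.toLp p (w - y)) (WithLp.toLp p (w - x))]
  have hU : (⋃ y ∈ s, T y) ⊆ f '' K := by
    intro w hw
    simp only [Set.mem_iUnion] at hw
    obtain ⟨y, hy, hw⟩ := hw
    obtain ⟨z, hz, rfl⟩ := hTeq y w hw
    obtain ⟨u, hu, hu'⟩ := hsub y hy z hz
    refine ⟨u, hu, ?_⟩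
    ext i
    rw [hf, ← hu' i]
    simp
  have hmain : (s.card : ℝ≥0∞) * (ENNReal.ofReal (δ ^ m) * volume K) ≤
      ENNReal.ofReal (∏ i, a i) * volume K := by
    rw [← hfv]
    refine le_trans ?_ (measure_mono hU)
    rw [measure_biUnion_finset hdisj fun y _ => hTmeas y, ← nsmul_eq_mul]
    exact Finset.card_nsmul_le_sum _ _ _ fun y _ => hTvol y
  rw [← mul_assoc, ENNReal.mul_le_mul_iff_left hKpos hKfin, ← ENNReal.ofReal_natCast,
    ← ENNReal.ofReal_mul (by positivity)] at hmain
  exact (ENNReal.ofReal_le_ofReal_iff (Finset.prod_nonneg fun i _ => ha i)).1 hmain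

lemma tail_nonneg9 (R : ℝ) (σ : ℕ → ℝ) (hσpos : ∀ k, 0 < σ k) (k : ℕ) :
    0 ≤ ∑' j : ℕ, if k ≤ j then σ j ^ R else 0 := by
  refine tsum_nonneg fun j => ?_
  split_ifs
  · exact Real.rpow_nonneg (hσpos j).le _
  · exact le_rfl

lemma tail_summable9 (R : ℝ) (σ : ℕ → ℝ) (hσpos : ∀ k, 0 < σ k)
    (hs : Summable (fun k : ℕ => σ k ^ R)) (k : ℕ) :
    Summable fun j : ℕ => if k ≤ j then σ j ^ R else 0 := by
  refine Summable.of_nonneg_of_le (fun j => ?_) (fun j => ?_) hs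
  · split_ifs
    · exact Real.rpow_nonneg (hσpos j).le _
    · exact le_rfl
  · split_ifs
    · exact le_rfl
    · exact Real.rpow_nonneg (hσpos j).le _

lemma tail_rpow9 (R : ℝ) (hR : 0 < R) (σ : ℕ → ℝ) (hσpos : ∀ k, 0 < σ k) (k : ℕ) :
    tailSeq R σ k ^ R = ∑' j : ℕ, if k ≤ j then σ j ^ R else 0 := by
  unfold tailSeq
  rw [← Real.rpow_mul (tail_nonneg9 R σ hσpos k), one_div, inv_mul_cancel₀ hR.ne', Real.rpow_one]

lemma tailSeq_nonneg9 (R : ℝ) (σ : ℕ → ℝ) (hσpos : ∀ k, 0 < σ k) (k : ℕ) :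
    0 ≤ tailSeq R σ k := Real.rpow_nonneg (tail_nonneg9 R σ hσpos k) _

lemma tail_anti9 (R : ℝ) (hR : 0 < R) (σ : ℕ → ℝ) (hσpos : ∀ k, 0 < σ k)
    (hs : Summable (fun k : ℕ => σ k ^ R)) (k : ℕ) : tailSeq R σ k ≤ tailSeq R σ 0 := by
  unfold tailSeq
  refine Real.rpow_le_rpow (tail_nonneg9 R σ hσpos k) ?_ (by positivity)
  refine (tail_summable9 R σ hσpos hs k).tsum_le_tsum (fun j => ?_) (tail_summable9 R σ hσpos hs 0)
  have := Real.rpow_nonneg (hσpos j).le R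
  split_ifs <;> simp_all

lemma tail_lim9 (R : ℝ) (hR : 0 < R) (σ : ℕ → ℝ) (hσpos : ∀ k, 0 < σ k)
    (hs : Summable (fun k : ℕ => σ k ^ R)) : Tendsto (tailSeq R σ) atTop (nhds 0) := by
  have e : ∀ k, (∑' j : ℕ, if k ≤ j then σ j ^ R else 0) = ∑' j, σ (j + k) ^ R := by
    intro k
    rw [← (tail_summable9 R σ hσpos hs k).sum_add_tsum_nat_add k, Finset.sum_eq_zero, zero_add]
    · simp
    · intro i hi
      rw [if_neg (by simpa using hi)]
  have h := tendsto_sum_nat_add (fun k => σ k ^ R)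
  have h2 := h.rpow_const (p := 1 / R) (Or.inr (by positivity))
  rw [Real.zero_rpow (by positivity)] at h2
  refine h2.congr fun k => ?_
  unfold tailSeq
  rw [e]

lemma bdd9 (R : ℝ) (hR : 1 ≤ R) (σ : ℕ → ℝ) (hσpos : ∀ k, 0 < σ k)
    (hs : Summable (fun k : ℕ => σ k ^ R)) (n : ℕ) (hn : 1 ≤ n) (k : ℕ) :
    ((∏ i ∈ Finset.range (k + 1),
              (tailSeq R σ k + 2 * (k + 1 : ℝ) ^ (1 / R) * σ i)) / n)
            ^ (1 / (k + 1 : ℝ)) ≤ 3 * tailSeq R σ 0 := by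
  have hR0 : 0 < R := by linarith
  have hk : (0 : ℝ) < k + 1 := by positivity
  set c := (k + 1 : ℝ) ^ (1 / R) with hc
  have cpos : 0 < c := by positivity
  have fpos : ∀ i, 0 ≤ tailSeq R σ k + 2 * c * σ i := fun i => by
    have := tailSeq_nonneg9 R σ hσpos k
    have := hσpos i
    positivity
  have hP : 0 ≤ ∏ i ∈ Finset.range (k + 1), (tailSeq R σ k + 2 * c * σ i) :=
    Finset.prod_nonneg fun i _ => fpos i
  have hn1 : (1 : ℝ) ≤ n := by exact_mod_cast hn
  have h1 := Real.rpow_le_rpow (by positivity) (div_le_self hP hn1)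
    (show 0 ≤ 1 / (k + 1 : ℝ) by positivity)
  refine h1.trans ?_
  rw [← Real.finsetProd_rpow _ _ fun i _ => fpos i]
  have hw : ∑ i ∈ Finset.range (k + 1), 1 / (k + 1 : ℝ) = 1 := by
    simp; field_simp
  refine (Real.geom_mean_le_arith_mean_weighted (Finset.range (k + 1)) (fun _ => 1 / (k + 1 : ℝ))
    (fun i => tailSeq R σ k + 2 * c * σ i) (fun i _ => by positivity) hw fun i _ => fpos i).trans ?_
  have hmean := Real.rpow_arith_mean_le_arith_mean_rpow (Finset.range (k + 1))
    (fun _ => 1 / (k + 1 : ℝ)) σ (fun i _ => by positivity) hw (fun i _ => (hσpos i).le) hR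
  set μ := ∑ i ∈ Finset.range (k + 1), 1 / (k + 1 : ℝ) * σ i with hμ
  have hμ0 : 0 ≤ μ := Finset.sum_nonneg fun i _ => by have := hσpos i; positivity
  have e : ∑ i ∈ Finset.range (k + 1), 1 / (k + 1 : ℝ) * (tailSeq R σ k + 2 * c * σ i)
      = tailSeq R σ k + 2 * (c * μ) := by
    simp only [mul_add, Finset.sum_add_distrib]
    rw [← Finset.sum_mul, hw, one_mul, hμ, Finset.mul_sum, Finset.mul_sum]
    congr 1
    exact Finset.sum_congr rfl fun i _ => by ring
  rw [e]
  have hcμ : c * μ ≤ tailSeq R σ 0 := by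
    rw [← Real.rpow_le_rpow_iff (by positivity) (tailSeq_nonneg9 R σ hσpos 0) hR0,
      tail_rpow9 R hR0 σ hσpos, Real.mul_rpow cpos.le hμ0, hc, ← Real.rpow_mul hk.le, one_div,
      inv_mul_cancel₀ hR0.ne', Real.rpow_one]
    rw [← Finset.mul_sum] at hmean
    calc (k + 1 : ℝ) * μ ^ R ≤ (k + 1 : ℝ) * (1 / (k + 1 : ℝ) *
          ∑ i ∈ Finset.range (k + 1), σ i ^ R) := mul_le_mul_of_nonneg_left hmean hk.le
      _ = ∑ i ∈ Finset.range (k + 1), σ i ^ R := by field_simp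
      _ ≤ ∑' i, σ i ^ R := hs.sum_le_tsum _ fun i _ => Real.rpow_nonneg (hσpos i).le _
      _ = _ := by simp
  linarith [tail_anti9 R hR0 σ hσpos hs k]

lemma pack9 (p : ℝ≥0∞) [Fact (1 ≤ p)] {m : ℕ} (δ : ℝ) (hδ : 0 < δ) (σ : ℕ → ℝ)
    (hσpos : ∀ k, 0 < σ k) (s : Finset (Fin m → ℝ))
    (hsA : ∀ y ∈ s, ∃ x : lp (fun _ : ℕ => ℝ) p, ‖x‖ ≤ 1 ∧ ∀ i, y i = σ i * x i)
    (hsep : ∀ x ∈ s, ∀ y ∈ s, x ≠ y → ¬ ‖WithLp.toLp p (x - y)‖ ≤ 2 * δ) :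
    (s.card : ℝ) * δ ^ m ≤ ∏ i ∈ Finset.range m, (2 * (σ i + δ)) := by
  rw [Finset.prod_range]
  refine vol9 p δ hδ _ (fun i => by have := hσpos i; positivity) s hsep ?_
  intro y hy z hz
  obtain ⟨x, hx, hyx⟩ := hsA y hy
  refine ⟨fun i => (y i + δ * z i) / (2 * (σ i + δ)), ?_, fun i => ?_⟩
  · rw [pilp9 p _ _ zero_le_one]
    have hz' := ((pilp9 p _ _ zero_le_one).1 hz).mono (y := fun i => |z i|) (by simp)
    have hx' := ((fin9 p m x 1).2 (lp9 p x 1 hx _)).mono (y := fun i : Fin m => |x i|) (by simp)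
    rw [← pilp9 p _ _ zero_le_one] at hz' hx'
    have hu : ‖(1 / 2 : ℝ) • (WithLp.toLp p (fun i : Fin m => |x i|) +
        WithLp.toLp p fun i : Fin m => |z i|)‖ ≤ 1 := by
      rw [norm_smul, Real.norm_of_nonneg (by norm_num)]
      linarith [norm_add_le (WithLp.toLp p (fun i : Fin m => |x i|))
        (WithLp.toLp p fun i : Fin m => |z i|)]
    rw [← WithLp.toLp_add, ← WithLp.toLp_smul, pilp9 p _ _ zero_le_one] at hu
    refine hu.mono fun i _ => ?_
    have hs := hσpos i
    have h2 : 0 < 2 * (σ i + δ) := by positivity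
    rw [abs_div, abs_of_pos h2, div_le_iff₀ h2, hyx]
    simp only [Pi.smul_apply, Pi.add_apply, smul_eq_mul]
    rw [abs_of_nonneg (by positivity : 0 ≤ 1 / 2 * (|x i| + |z i|))]
    have h3 := abs_add_le (σ i * x i) (δ * z i)
    rw [abs_mul, abs_mul, abs_of_pos hs, abs_of_pos hδ] at h3
    nlinarith [mul_nonneg hs.le (abs_nonneg (z i)), mul_nonneg hδ.le (abs_nonneg (x i))]
  · have hs := hσpos i
    field_simp

lemma final9 (p q r : ℝ≥0∞) [Fact (1 ≤ p)] [Fact (1 ≤ q)]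
    (hqp : q < p) (hr : 1 / q = 1 / p + 1 / r)
    (σ : ℕ → ℝ) (hσpos : ∀ k, 0 < σ k)
    (hσsum : Summable (fun k : ℕ => σ k ^ r.toReal))
    (D : lp (fun _ : ℕ => ℝ) p →L[ℝ] lp (fun _ : ℕ => ℝ) q)
    (hD : ∀ (x : lp (fun _ : ℕ => ℝ) p) (k : ℕ), D x k = σ k * x k)
    (n m : ℕ) (ε δ : ℝ) (hε : 0 < ε) (hδ : 0 ≤ δ)
    (hδε : (m : ℝ) ^ (1 / r.toReal) * (2 * δ) ≤ ε) (htail : tailSeq r.toReal σ m ≤ ε)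
    (s : Finset (Fin m → ℝ)) (hs : s.card ≤ n)
    (hcov : ∀ x : lp (fun _ : ℕ => ℝ) p, ‖x‖ ≤ 1 →
      ∃ z ∈ s, ‖WithLp.toLp p ((fun i : Fin m => σ i * x i) - z)‖ ≤ 2 * δ) :
    entropyNumber n (D '' Metric.closedBall 0 1) ≤ 2 * ε := by
  classical
  have h1p : 1 ≤ p := Fact.out
  have h1q : 1 ≤ q := Fact.out
  have hqt : q ≠ ∞ := (lt_of_lt_of_le hqp le_top).ne
  have hq0 : q ≠ 0 := (zero_lt_one.trans_le h1q).ne'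
  obtain ⟨h1r, hrt⟩ := rr9 h1q hqp hr
  have hr0 : r ≠ 0 := (zero_lt_one.trans_le h1r).ne'
  have qpos : 0 < q.toReal := ENNReal.toReal_pos hq0 hqt
  have rpos : 0 < r.toReal := ENNReal.toReal_pos hr0 hrt
  let H : (ℕ → ℝ) → lp (fun _ : ℕ => ℝ) q :=
    fun v => ∑ i ∈ Finset.range m, lp.single q i (v i)
  have hH : ∀ v i, H v i = if i < m then v i else 0 := by
    intro v i
    simp only [H, lp.coeFn_sum, Finset.sum_apply, lp.coeFn_single, Finset.sum_pi_single,
      Finset.mem_range]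
  let E : (Fin m → ℝ) → ℕ → ℝ := fun z i => if h : i < m then z ⟨i, h⟩ else 0
  refine csInf_le ⟨0, fun x hx => hx.1.le⟩ ⟨by positivity, ?_⟩
  let y : Fin n → lp (fun _ : ℕ => ℝ) q := fun j =>
    if h : j.1 < s.card then H (E (s.equivFin.symm ⟨j.1, h⟩).1) else 0
  refine ⟨y, ?_⟩
  rintro _ ⟨x, hx, rfl⟩
  rw [mem_closedBall_zero_iff] at hx
  obtain ⟨z, hz, hzx⟩ := hcov x hx
  rw [Set.mem_iUnion]
  refine ⟨⟨(s.equivFin ⟨z, hz⟩).1, (s.equivFin ⟨z, hz⟩).2.trans_le hs⟩, ?_⟩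
  have hy : y ⟨(s.equivFin ⟨z, hz⟩).1, (s.equivFin ⟨z, hz⟩).2.trans_le hs⟩ = H (E z) := by
    simp [y]
  rw [hy, mem_closedBall_iff_norm]
  have e : D x - H (E z) = (D x - H (fun i => σ i * x i)) + (H (fun i => σ i * x i) - H (E z)) := by
    abel
  have b1 : ‖D x - H (fun i => σ i * x i)‖ ≤ ε := by
    refine le_trans ?_ htail
    have t0 := tailSeq_nonneg9 r.toReal σ hσpos m
    refine lp.norm_le_of_forall_sum_le qpos t0 fun t => ?_
    have := holder9 h1p h1q hqp hr t (fun i => if m ≤ i then σ i else 0) x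
      (tailSeq r.toReal σ m) 1 t0 zero_le_one
      (fun i => by split_ifs; exacts [(hσpos i).le, le_rfl]) (lp9 p x 1 hx t) (by
        rw [tail_rpow9 r.toReal rpos σ hσpos]
        refine le_trans (le_of_eq ?_) ((tail_summable9 r.toReal σ hσpos hσsum m).sum_le_tsum t ?_)
        · refine Finset.sum_congr rfl fun i _ => ?_
          split_ifs
          · rfl
          · exact Real.zero_rpow rpos.ne'
        · intro i _
          split_ifs
          exacts [Real.rpow_nonneg (hσpos i).le _, le_rfl])
    rw [mul_one] at this
    refine le_trans (le_of_eq (Finset.sum_congr rfl fun i _ => ?_)) this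
    have : (D x - H fun i => σ i * x i) i = (if m ≤ i then σ i else 0) * x i := by
      rw [lp.coeFn_sub, Pi.sub_apply, hD, hH]
      by_cases h : m ≤ i
      · rw [if_neg (by omega), if_pos h]; ring
      · rw [if_pos (by omega), if_neg h]; ring
    rw [this, Real.norm_eq_abs]
  have b2 : ‖H (fun i => σ i * x i) - H (E z)‖ ≤ ε := by
    have e2 : H (fun i => σ i * x i) - H (E z) = H (fun i => σ i * x i - E z i) := by
      ext i
      rw [lp.coeFn_sub, Pi.sub_apply, hH, hH, hH]
      split_ifs <;> ring
    rw [e2, ← Real.rpow_le_rpow_iff (norm_nonneg _) hε.le qpos]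
    simp only [H]
    rw [lp.norm_sum_single qpos (fun i => σ i * x i - E z i)]
    rw [pilp9 p _ _ (by positivity)] at hzx
    have h3 : PB9 p (Finset.range m) (fun i => σ i * x i - E z i) (2 * δ) := by
      rw [← fin9]
      refine hzx.mono fun i _ => ?_
      simp [E]
    have := holder9 h1p h1q hqp hr (Finset.range m) (fun _ => 1) _
      ((m : ℝ) ^ (1 / r.toReal)) (2 * δ) (by positivity) (by positivity)
      (fun _ => zero_le_one) h3 (by
        rw [← Real.rpow_mul (by positivity), one_div, inv_mul_cancel₀ rpos.ne']
        simp)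
    simp only [one_mul] at this
    exact this.trans (Real.rpow_le_rpow (by positivity) hδε qpos.le)
  rw [e]
  linarith [norm_add_le (D x - H (fun i => σ i * x i)) (H (fun i => σ i * x i) - H (E z))]

/-- **Lemma 2.6 (upper bound for `p > q`, explicit constants).**
Let `1 ≤ q < p ≤ ∞` with `1/q = 1/p + 1/r` and let `σ` be a non-increasing sequence of
positive reals tending to zero with `∑_k σ_k^r < ∞` (here `σ k` denotes the `(k+1)`-st
term `σ_{k+1}` of the paper, and `tailSeq r.toReal σ k` is the tail `τ_{k+1}`).  Then for
all `n ≥ 1` the diagonal operator `D_σ : ℓ_p → ℓ_q` satisfies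
`e_n(D_σ) ≤ 4 ⬝ sup_{k ≥ 1} ((τ_k + 2 k^{1/r} σ_1)⋯(τ_k + 2 k^{1/r} σ_k)/n)^{1/k}`. -/
theorem statement9 (p q r : ℝ≥0∞) [Fact (1 ≤ p)] [Fact (1 ≤ q)]
    (hqp : q < p) (hr : 1 / q = 1 / p + 1 / r)
    (σ : ℕ → ℝ) (hσpos : ∀ k, 0 < σ k) (hσanti : Antitone σ)
    (hσlim : Tendsto σ atTop (nhds 0))
    (hσsum : Summable (fun k : ℕ => σ k ^ r.toReal))
    (D : lp (fun _ : ℕ => ℝ) p →L[ℝ] lp (fun _ : ℕ => ℝ) q)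
    (hD : ∀ (x : lp (fun _ : ℕ => ℝ) p) (k : ℕ), D x k = σ k * x k) :
    ∀ n : ℕ, 1 ≤ n →
      entropyNumber n (D '' Metric.closedBall 0 1) ≤
        4 * ⨆ k : ℕ,
          ((∏ i ∈ Finset.range (k + 1),
              (tailSeq r.toReal σ k + 2 * (k + 1 : ℝ) ^ (1 / r.toReal) * σ i)) / n)
            ^ (1 / (k + 1 : ℝ)) := by
  intro n hn
  have h1q : 1 ≤ q := Fact.out
  obtain ⟨h1r, hrt⟩ := rr9 h1q hqp hr
  have hr0 : r ≠ 0 := (zero_lt_one.trans_le h1r).ne'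
  have rpos : 0 < r.toReal := ENNReal.toReal_pos hr0 hrt
  have h1R : 1 ≤ r.toReal := by
    have := ENNReal.toReal_mono hrt h1r
    simpa using this
  have hnpos : (0 : ℝ) < n := by exact_mod_cast hn
  set R := r.toReal with hRdef
  set F : ℕ → ℝ := fun k => ((∏ i ∈ Finset.range (k + 1),
              (tailSeq R σ k + 2 * (k + 1 : ℝ) ^ (1 / R) * σ i)) / n)
            ^ (1 / (k + 1 : ℝ)) with hF
  set M := ⨆ k, F k with hM
  have hbdd : BddAbove (Set.range F) :=
    ⟨3 * tailSeq R σ 0, by rintro _ ⟨k, rfl⟩; exact bdd9 R h1R σ hσpos hσsum n hn k⟩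
  have hFM : ∀ k, F k ≤ M := fun k => le_ciSup hbdd k
  have fpos : ∀ k i, 0 < tailSeq R σ k + 2 * (k + 1 : ℝ) ^ (1 / R) * σ i := fun k i => by
    have := tailSeq_nonneg9 R σ hσpos k
    have := hσpos i
    positivity
  have Ppos : ∀ k, 0 < ∏ i ∈ Finset.range (k + 1),
      (tailSeq R σ k + 2 * (k + 1 : ℝ) ^ (1 / R) * σ i) :=
    fun k => Finset.prod_pos fun i _ => fpos k i
  have hMpos : 0 < M := lt_of_lt_of_le (Real.rpow_pos_of_pos (div_pos (Ppos 0) hnpos) _) (hFM 0)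
  have hP : ∀ k, ∏ i ∈ Finset.range (k + 1),
      (tailSeq R σ k + 2 * (k + 1 : ℝ) ^ (1 / R) * σ i) ≤ n * M ^ (k + 1) := by
    intro k
    have h := hFM k
    simp only [hF] at h
    rw [one_div (k + 1 : ℝ), Real.rpow_inv_le_iff_of_pos (div_pos (Ppos k) hnpos).le hMpos.le
      (by positivity), div_le_iff₀ hnpos] at h
    rw [mul_comm (n : ℝ)]
    exact_mod_cast h
  have h4 : 4 * M = 2 * (2 * M) := by ring
  rw [h4]
  have hex : ∃ m, tailSeq R σ m ≤ 2 * M := by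
    have := (tail_lim9 R rpos σ hσpos hσsum).eventually (eventually_le_nhds (b := 2 * M) (by positivity))
    exact this.exists
  classical
  have hspec := Nat.find_spec hex
  rcases hm : Nat.find hex with _ | k
  · rw [hm] at hspec
    refine final9 p q r hqp hr σ hσpos hσsum D hD n 0 (2 * M) 0 (by positivity) le_rfl
      (by simp; positivity) hspec {0} (by simpa using hn) fun x _ => ⟨0, by simp, ?_⟩
    rw [Subsingleton.elim (WithLp.toLp p ((fun i : Fin 0 => σ i * x i) - 0)) 0]
    simp
  · rw [hm] at hspec
    have hk : 2 * M < tailSeq R σ k := by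
      have := Nat.find_min hex (m := k) (by omega)
      exact not_le.1 this
    set c := (k + 1 : ℝ) ^ (1 / R) with hc
    have cpos : 0 < c := by positivity
    have hδ : 0 < M / c := by positivity
    obtain ⟨s, hs, -, hcov⟩ := cover9
      {y : Fin (k + 1) → ℝ | ∃ x : lp (fun _ : ℕ => ℝ) p, ‖x‖ ≤ 1 ∧ ∀ i, y i = σ i * x i}
      (fun y z => ‖WithLp.toLp p (y - z)‖ ≤ 2 * (M / c))
      (fun y => by simp; positivity)
      (fun y z h => by
        rw [← neg_sub, WithLp.toLp_neg, norm_neg]; exact h) n (by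
        intro s hsA hsep
        have h := pack9 p (M / c) hδ σ hσpos s hsA hsep
        have h2 : ∏ i ∈ Finset.range (k + 1), (2 * (σ i + M / c)) ≤
            (∏ i ∈ Finset.range (k + 1), (tailSeq R σ k + 2 * c * σ i)) / c ^ (k + 1) := by
          have : ∀ t : ℝ, t / c ^ (k + 1) = t / ∏ i ∈ Finset.range (k + 1), c := by simp
          rw [this, ← Finset.prod_div_distrib]
          refine Finset.prod_le_prod (fun i _ => by have := hσpos i; positivity) fun i _ => ?_
          rw [le_div_iff₀ cpos]
          have : 2 * (σ i + M / c) * c = 2 * c * σ i + 2 * M := by field_simp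
          linarith
        have h3 := h.trans (h2.trans (div_le_div_of_nonneg_right (hP k) (by positivity)))
        rw [div_pow, ← mul_div_assoc, div_le_div_iff_of_pos_right (by positivity),
          mul_le_mul_iff_left₀ (by positivity)] at h3
        exact_mod_cast h3)
    refine final9 p q r hqp hr σ hσpos hσsum D hD n (k + 1) (2 * M) (M / c) (by positivity) hδ.le
      (le_of_eq ?_) hspec s hs fun x hx => hcov _ ⟨x, hx, fun i => rfl⟩
    push_cast
    rw [← hRdef, ← hc]
    field_simp
end

section
/- Let σ = (σ_k)_{k≥1} be a non-increasing sequence of positive real numbers with σ_k → 0. Then the following are equivalent: (i) there exists a real number b > 1 such that sup{ σ_n b^n / (σ_k b^k) : (n,k) ∈ ℕ², k ≤ n } < ∞; (ii) there exist a natural number n₀ ≥ 1 and a real number a with 0 < a < 1 such that σ_{k+n₀} ≤ a · σ_k for all k ≥ 1. -/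
open Filter

/-- **Lemma (EXP sequences), (i) ⟺ (ii).**
For a non-increasing positive sequence `σ` (indexed from 1) tending to zero, the
condition (EXP) `∃ b > 1, sup_{k ≤ n} σ_n b^n / (σ_k b^k) < ∞` is equivalent to the
existence of `n₀ ≥ 1` and `0 < a < 1` with `σ_{k+n₀} ≤ a σ_k` for all `k ≥ 1`. -/
theorem statement11 (σ : ℕ → ℝ)
    (hpos : ∀ k, 1 ≤ k → 0 < σ k)
    (hanti : ∀ m n : ℕ, 1 ≤ m → m ≤ n → σ n ≤ σ m)
    (hlim : Tendsto σ atTop (nhds 0)) :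
    (∃ b : ℝ, 1 < b ∧ ∃ C : ℝ, ∀ k n : ℕ, 1 ≤ k → k ≤ n →
        σ n * b ^ n / (σ k * b ^ k) ≤ C) ↔
    (∃ n₀ : ℕ, 1 ≤ n₀ ∧ ∃ a : ℝ, 0 < a ∧ a < 1 ∧ ∀ k : ℕ, 1 ≤ k →
        σ (k + n₀) ≤ a * σ k) := by
  constructor
  · rintro ⟨b, hb, C, hC⟩
    obtain ⟨N, hN⟩ := pow_unbounded_of_one_lt (2 * C) hb
    have hb0 : 0 < b := by linarith
    refine ⟨N + 1, by omega, 1 / 2, by norm_num, by norm_num, fun k hk => ?_⟩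
    have h := hC k (k + (N + 1)) hk (by omega)
    have hk0 := hpos k hk
    have hbk : 0 < b ^ k := pow_pos hb0 k
    rw [div_le_iff₀ (by positivity), pow_add] at h
    have h2 : σ (k + (N + 1)) * b ^ (N + 1) ≤ C * σ k := by
      refine le_of_mul_le_mul_right ?_ hbk
      linarith
    have h3 : 2 * C ≤ b ^ (N + 1) :=
      hN.le.trans (pow_le_pow_right₀ hb.le (by omega))
    have h4 : 0 < b ^ (N + 1) := pow_pos hb0 _
    refine le_of_mul_le_mul_right (a := b ^ (N + 1)) ?_ h4
    nlinarith
  · rintro ⟨m, hm, a, ha, ha1, h⟩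
    obtain ⟨b, hb, hab⟩ : ∃ b : ℝ, 1 < b ∧ a * b ^ m = 1 := by
      refine ⟨(a⁻¹) ^ ((m : ℝ)⁻¹), ?_, ?_⟩
      · exact Real.one_lt_rpow ((one_lt_inv₀ ha).2 ha1) (by positivity)
      · rw [Real.rpow_inv_natCast_pow (by positivity) (by omega)]
        exact mul_inv_cancel₀ ha.ne'
    have hb0 : 0 < b := by linarith
    have key : ∀ d k : ℕ, 1 ≤ k → σ (k + d) * b ^ d ≤ b ^ m * σ k := by
      intro d
      induction d using Nat.strong_induction_on with
      | _ d ih =>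
        intro k hk
        rcases lt_or_ge d m with hd | hd
        · rw [mul_comm]
          exact mul_le_mul (pow_le_pow_right₀ hb.le hd.le) (hanti _ _ hk (by omega))
            (hpos _ (by omega)).le (by positivity)
        · obtain ⟨e, rfl⟩ := Nat.exists_eq_add_of_le' hd
          have h1 := ih e (by omega) k hk
          have h2 := h (k + e) (by omega)
          calc σ (k + (e + m)) * b ^ (e + m) = σ (k + e + m) * (b ^ e * b ^ m) := by
                rw [pow_add, add_assoc]
            _ ≤ a * σ (k + e) * (b ^ e * b ^ m) := by gcongr
            _ = (a * b ^ m) * (σ (k + e) * b ^ e) := by ring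
            _ ≤ _ := by rw [hab, one_mul]; exact h1
    refine ⟨b, hb, b ^ m, fun k n hk hn => ?_⟩
    obtain ⟨d, rfl⟩ := Nat.exists_eq_add_of_le hn
    have hk0 := hpos k hk
    rw [div_le_iff₀ (by positivity), pow_add]
    have := mul_le_mul_of_nonneg_right (key d k hk) (pow_pos hb0 k).le
    linarith
end
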